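/- arXiv:1805.06685 — 2 statements merged into one kernel-verified Lean document; each statement's English description precedes it below -/
import Mathlib

section
/- Let 𝓜 be a finite nonempty set of n×n binary NZ matrices and t ≥ 0 with K_𝓜(t) = K_𝓜(t+1). Then P_{t+1} ⊆ P_t, and for every M ∈ 𝓜, every binary row-stochastic matrix R with R ≤ M entrywise, and every p ∈ P_{t+1}, the vector Rᵀp belongs to P_t. -/
open scoped BigOperators

/-- Binary (Boolean) `n × n` matrices. -/
abbrev BMat (n : ℕ) := Matrix (Fin n) (Fin n) Bool

/-- Boolean matrix product: `(A ⊙ B)[i,j] = 1` iff `∑ₖ A[i,k]·B[k,j] > 0`. -/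
def bProd {n : ℕ} (A B : BMat n) : BMat n :=
  Matrix.of fun i j => decide (∃ k, A i k = true ∧ B k j = true)

/-- The identity binary matrix. -/
def bId (n : ℕ) : BMat n := Matrix.of fun i j => decide (i = j)

/-- The all-ones binary matrix. -/
def bOnes (n : ℕ) : BMat n := Matrix.of fun _ _ => true

/-- Boolean product of a list of binary matrices (empty product = identity). -/
def listProd {n : ℕ} (l : List (BMat n)) : BMat n := l.foldr bProd (bId n)

/-- A binary matrix is NZ if every row and every column contains a `1`. -/
def IsNZ {n : ℕ} (A : BMat n) : Prop :=
  (∀ i, ∃ j, A i j = true) ∧ (∀ j, ∃ i, A i j = true)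

/-- `𝓜^{≤t}`: all boolean products of at most `t` matrices from `M`. -/
def prodsLe {n : ℕ} (M : Set (BMat n)) (t : ℕ) : Set (BMat n) :=
  { P | ∃ l : List (BMat n), l.length ≤ t ∧ (∀ A ∈ l, A ∈ M) ∧ P = listProd l }

/-- `𝓜^{t}`: all boolean products of exactly `t` matrices from `M`. -/
def prodsEq {n : ℕ} (M : Set (BMat n)) (t : ℕ) : Set (BMat n) :=
  { P | ∃ l : List (BMat n), l.length = t ∧ (∀ A ∈ l, A ∈ M) ∧ P = listProd l }

/-- `(Ae)_i`: the number of `1`-entries in row `i` of `A`, as a real number. -/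
def rowSum {n : ℕ} (A : BMat n) (i : Fin n) : ℝ :=
  ∑ j, if A i j then (1 : ℝ) else 0

/-- The number of `1`-entries in row `i` of `A`, as a natural number. -/
def rCount {n : ℕ} (A : BMat n) (i : Fin n) : ℕ :=
  (Finset.univ.filter fun j => A i j = true).card

/-- A stochastic vector: nonnegative entries summing to `1`. -/
def IsStochastic {m : ℕ} (p : Fin m → ℝ) : Prop :=
  (∀ i, 0 ≤ p i) ∧ ∑ i, p i = 1

/-- `pᵀ(Ae)`. -/
def payoff {n : ℕ} (p : Fin n → ℝ) (A : BMat n) : ℝ := ∑ i, p i * rowSum A i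

/-- `max_{A ∈ 𝓜^{≤t}} pᵀ(Ae)`. -/
noncomputable def maxPayoff {n : ℕ} (M : Set (BMat n)) (t : ℕ) (p : Fin n → ℝ) : ℝ :=
  sSup { x | ∃ A ∈ prodsLe M t, x = payoff p A }

/-- The synchronizing probability function
`K_𝓜(t) = min_p max_{A ∈ 𝓜^{≤t}} pᵀ(Ae)/n`. -/
noncomputable def Kval {n : ℕ} (M : Set (BMat n)) (t : ℕ) : ℝ :=
  sInf { v | ∃ p : Fin n → ℝ, IsStochastic p ∧ v = maxPayoff M t p } / n

/-- The set `P_t` of optimal stochastic vectors for `K_𝓜(t)`. -/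
noncomputable def Pset {n : ℕ} (M : Set (BMat n)) (t : ℕ) : Set (Fin n → ℝ) :=
  { p | IsStochastic p ∧ maxPayoff M t p = n * Kval M t }

/-- A set of binary matrices is primitive if some (nonempty) boolean product of its
elements equals the all-ones matrix. -/
def IsPrimitive {n : ℕ} (M : Set (BMat n)) : Prop :=
  ∃ l : List (BMat n), l ≠ [] ∧ (∀ A ∈ l, A ∈ M) ∧ listProd l = bOnes n

/-- The exponent of a primitive set: the length of its shortest positive product. -/
noncomputable def expM {n : ℕ} (M : Set (BMat n)) : ℕ :=
  sInf { t | ∃ l : List (BMat n),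
    l.length = t ∧ l ≠ [] ∧ (∀ A ∈ l, A ∈ M) ∧ listProd l = bOnes n }

/-- `max_{A ∈ 𝓜^{≤t}} r_i(A)`. -/
noncomputable def rowMaxN {n : ℕ} (M : Set (BMat n)) (t : ℕ) (i : Fin n) : ℕ :=
  sSup { r | ∃ A ∈ prodsLe M t, r = rCount A i }

/-- `min_{1≤i≤n} max_{A ∈ 𝓜^{≤t}} r_i(A)`. -/
noncomputable def KbarN {n : ℕ} (M : Set (BMat n)) (t : ℕ) : ℕ :=
  sInf { r | ∃ i : Fin n, r = rowMaxN M t i }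

/-- The approximated synchronizing probability function
`K̄_𝓜(t) = (1/n)·min_i max_{A ∈ 𝓜^{≤t}} r_i(A)`. -/
noncomputable def Kbar {n : ℕ} (M : Set (BMat n)) (t : ℕ) : ℝ := (KbarN M t : ℝ) / n

/-- `P̄_t`: the set of row indices attaining the minimum in `K̄_𝓜(t)`. -/
noncomputable def Pbar {n : ℕ} (M : Set (BMat n)) (t : ℕ) : Set (Fin n) :=
  { i | rowMaxN M t i = KbarN M t }

theorem bId_mem_prodsLe {n : ℕ} (M : Set (BMat n)) (t : ℕ) : bId n ∈ prodsLe M t :=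
  ⟨[], by simp, by simp, rfl⟩

theorem prodsLe_mono {n : ℕ} (M : Set (BMat n)) : Monotone (prodsLe M) := by
  rintro s t hst P ⟨l, hl, hM, rfl⟩
  exact ⟨l, hl.trans hst, hM, rfl⟩

theorem bProd_mem_prodsLe {n : ℕ} {M : Set (BMat n)} {t : ℕ} {A B : BMat n}
    (hA : A ∈ M) (hB : B ∈ prodsLe M t) : bProd A B ∈ prodsLe M (t + 1) := by
  obtain ⟨l, hl, hM, rfl⟩ := hB
  exact ⟨A :: l, by simpa using hl, by simpa [hA] using hM, rfl⟩

theorem rowSum_nonneg {n : ℕ} (A : BMat n) (i : Fin n) : 0 ≤ rowSum A i :=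
  Finset.sum_nonneg fun j _ => by split_ifs <;> norm_num

theorem rowSum_le_rowSum_bProd {n : ℕ} {A : BMat n} {i j : Fin n} (h : A i j = true)
    (B : BMat n) : rowSum B j ≤ rowSum (bProd A B) i := by
  refine Finset.sum_le_sum fun k _ => ?_
  by_cases hB : B j k = true
  · have : bProd A B i k = true := by
      simpa [bProd] using ⟨j, h, hB⟩
    simp [hB, this]
  · rw [if_neg hB]
    split_ifs <;> norm_num

theorem payoff_nonneg {n : ℕ} {p : Fin n → ℝ} (hp : IsStochastic p) (A : BMat n) :
    0 ≤ payoff p A :=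
  Finset.sum_nonneg fun i _ => mul_nonneg (hp.1 i) (rowSum_nonneg A i)

theorem payoff_le_maxPayoff {n : ℕ} {M : Set (BMat n)} {t : ℕ} {A : BMat n}
    (hA : A ∈ prodsLe M t) (p : Fin n → ℝ) : payoff p A ≤ maxPayoff M t p := by
  refine le_csSup (Set.Finite.bddAbove ?_) ⟨A, hA, rfl⟩
  refine (Set.finite_range (payoff p)).subset ?_
  rintro _ ⟨B, -, rfl⟩
  exact ⟨B, rfl⟩

theorem maxPayoff_le {n : ℕ} {M : Set (BMat n)} {t : ℕ} {p : Fin n → ℝ} {c : ℝ}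
    (h : ∀ A ∈ prodsLe M t, payoff p A ≤ c) : maxPayoff M t p ≤ c := by
  refine csSup_le ⟨_, bId n, bId_mem_prodsLe M t, rfl⟩ ?_
  rintro _ ⟨A, hA, rfl⟩
  exact h A hA

theorem mul_Kval_le_maxPayoff {n : ℕ} (hn : 1 ≤ n) (M : Set (BMat n)) (t : ℕ)
    {p : Fin n → ℝ} (hp : IsStochastic p) : n * Kval M t ≤ maxPayoff M t p := by
  have hn0 : (n : ℝ) ≠ 0 := by exact_mod_cast (by omega : n ≠ 0)
  rw [Kval, mul_div_cancel₀ _ hn0]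
  refine csInf_le ⟨0, ?_⟩ ⟨p, hp, rfl⟩
  rintro _ ⟨q, hq, rfl⟩
  exact (payoff_nonneg hq _).trans (payoff_le_maxPayoff (bId_mem_prodsLe M t) q)

theorem sum_sum_ite_mul_eq {n : ℕ} {R : BMat n} {r : Fin n → Fin n}
    (hr : ∀ i j, R i j = true ↔ j = r i) (p f : Fin n → ℝ) :
    ∑ j, (∑ i, if R i j then p i else 0) * f j = ∑ i, p i * f (r i) := by
  simp only [Finset.sum_mul, ite_mul, zero_mul]
  rw [Finset.sum_comm]
  simp [hr]

/-- if `K_𝓜(t) = K_𝓜(t+1)` then `P_{t+1} ⊆ P_t`, and for every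
binary row-stochastic `R` dominated by some `M ∈ 𝓜` and every `p ∈ P_{t+1}`,
the vector `Rᵀp` belongs to `P_t`. -/
theorem stmt_11 {n : ℕ} (hn : 1 ≤ n) (M : Set (BMat n)) (hfin : M.Finite)
    (hne : M.Nonempty) (hNZ : ∀ A ∈ M, IsNZ A) (t : ℕ)
    (heq : Kval M t = Kval M (t + 1)) :
    Pset M (t + 1) ⊆ Pset M t ∧
    ∀ M0 ∈ M, ∀ R : BMat n,
      (∀ i, ∃! j, R i j = true) →
      (∀ i j, R i j = true → M0 i j = true) →
      ∀ p ∈ Pset M (t + 1),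
        (fun j => ∑ i, if R i j then p i else 0) ∈ Pset M t := by
  have mem_of_le : ∀ {p q : Fin n → ℝ}, p ∈ Pset M (t + 1) → IsStochastic q →
      maxPayoff M t q ≤ maxPayoff M (t + 1) p → q ∈ Pset M t := by
    intro p q hp hq hle
    refine ⟨hq, le_antisymm ?_ (mul_Kval_le_maxPayoff hn M t hq)⟩
    rwa [heq, ← hp.2]
  refine ⟨fun p hp => mem_of_le hp hp.1 (maxPayoff_le fun A hA =>
    payoff_le_maxPayoff (prodsLe_mono M t.le_succ hA) p), ?_⟩
  intro M0 hM0 R hR hRM p hp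
  choose r hr hr_unique using hR
  have hrow : ∀ i j, R i j = true ↔ j = r i := fun i j =>
    ⟨hr_unique i j, fun h => h ▸ hr i⟩
  refine mem_of_le hp ⟨fun j => Finset.sum_nonneg fun i _ => ?_, ?_⟩
    (maxPayoff_le fun A hA => ?_)
  · split_ifs
    exacts [hp.1.1 i, le_rfl]
  · simpa [hp.1.2] using sum_sum_ite_mul_eq hrow p fun _ => 1
  · refine le_trans ?_ (payoff_le_maxPayoff (bProd_mem_prodsLe hM0 hA) p)
    rw [payoff, sum_sum_ite_mul_eq hrow]
    exact Finset.sum_le_sum fun i _ => mul_le_mul_of_nonneg_left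
      (rowSum_le_rowSum_bProd (hRM i _ (hr i)) A) (hp.1.1 i)
end

section
/- Let n ≥ 2 and let 𝓜 be a primitive finite set of n×n binary NZ matrices. Then K̄_𝓜(n) > K̄_𝓜(0) = 1/n. -/
open scoped BigOperators

theorem bProd_apply_iff {n : ℕ} (A B : BMat n) (i j : Fin n) :
    bProd A B i j = true ↔ ∃ k, A i k = true ∧ B k j = true := by
  simp [bProd]

theorem bId_apply_iff {n : ℕ} (i j : Fin n) : bId n i j = true ↔ i = j := by
  simp [bId]

theorem listProd_append_singleton_apply_iff {n : ℕ} (l : List (BMat n)) (A : BMat n)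
    (i j : Fin n) :
    listProd (l ++ [A]) i j = true ↔ ∃ k, listProd l i k = true ∧ A k j = true := by
  induction l generalizing i with
  | nil => simp [listProd, bProd_apply_iff, bId_apply_iff]
  | cons B l ih =>
    have h (l : List (BMat n)) : listProd (B :: l) = bProd B (listProd l) := rfl
    simp only [List.cons_append, h, bProd_apply_iff, ih]
    grind

/-- A set of indices closed under the nonzero entries of the matrices of `M` is closed under the
nonzero entries of their products. -/
theorem mem_of_listProd_apply {n : ℕ} {M : Set (BMat n)} {S : Set (Fin n)}
    (hS : ∀ A ∈ M, ∀ k ∈ S, ∀ j, A k j = true → j ∈ S) {l : List (BMat n)}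
    (hl : ∀ A ∈ l, A ∈ M) {i j : Fin n} (hi : i ∈ S) (hij : listProd l i j = true) : j ∈ S := by
  induction l generalizing i with
  | nil => exact (bId_apply_iff i j).1 hij ▸ hi
  | cons B l ih =>
    obtain ⟨k, hk, hkj⟩ := (bProd_apply_iff B (listProd l) i j).1 hij
    exact ih (fun A hA => hl A (List.mem_cons_of_mem _ hA))
      (hS B (hl B List.mem_cons_self) i hi k hk) hkj

/-- If the rows of all factors have at most one nonzero entry, so do the rows of the product. -/
theorem listProd_apply_unique {n : ℕ} {l : List (BMat n)}
    (hl : ∀ A ∈ l, ∀ k j j', A k j = true → A k j' = true → j = j') {i j j' : Fin n}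
    (hj : listProd l i j = true) (hj' : listProd l i j' = true) : j = j' := by
  induction l generalizing i with
  | nil => exact ((bId_apply_iff i j).1 hj).symm.trans ((bId_apply_iff i j').1 hj')
  | cons B l ih =>
    obtain ⟨k, hk, hkj⟩ := (bProd_apply_iff B (listProd l) i j).1 hj
    obtain ⟨k', hk', hkj'⟩ := (bProd_apply_iff B (listProd l) i j').1 hj'
    obtain rfl := hl B List.mem_cons_self i k k' hk hk'
    exact ih (fun A hA => hl A (List.mem_cons_of_mem _ hA)) hkj hkj'

theorem IsPrimitive.exists_branching_row {n : ℕ} (hn : 2 ≤ n) {M : Set (BMat n)}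
    (hprim : IsPrimitive M) :
    ∃ A ∈ M, ∃ k j j', A k j = true ∧ A k j' = true ∧ j ≠ j' := by
  obtain ⟨l, -, hl, hprod⟩ := hprim
  by_contra! h
  have := listProd_apply_unique (l := l) (fun A hA => h A (hl A hA))
    (i := ⟨0, by omega⟩) (j := ⟨0, by omega⟩) (j' := ⟨1, by omega⟩)
    (by simp [hprod, bOnes]) (by simp [hprod, bOnes])
  simp at this

/-- The indices reached from `i` by products of at most `t` matrices of `M`. -/
def reachSet {n : ℕ} (M : Set (BMat n)) (i : Fin n) (t : ℕ) : Set (Fin n) :=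
  {j | ∃ A ∈ prodsLe M t, A i j = true}

theorem mem_reachSet_self {n : ℕ} (M : Set (BMat n)) (i : Fin n) (t : ℕ) :
    i ∈ reachSet M i t :=
  ⟨bId n, ⟨[], by simp, by simp, rfl⟩, (bId_apply_iff i i).2 rfl⟩

theorem reachSet_subset_succ {n : ℕ} (M : Set (BMat n)) (i : Fin n) (t : ℕ) :
    reachSet M i t ⊆ reachSet M i (t + 1) := by
  rintro j ⟨A, ⟨l, hlen, hl, rfl⟩, hj⟩
  exact ⟨_, ⟨l, by omega, hl, rfl⟩, hj⟩

theorem mem_reachSet_succ {n : ℕ} {M : Set (BMat n)} {i k j : Fin n} {t : ℕ} {A : BMat n}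
    (hA : A ∈ M) (hk : k ∈ reachSet M i t) (hkj : A k j = true) : j ∈ reachSet M i (t + 1) := by
  obtain ⟨_, ⟨l, hlen, hl, rfl⟩, hik⟩ := hk
  refine ⟨_, ⟨l ++ [A], by simpa using hlen, ?_, rfl⟩,
    (listProd_append_singleton_apply_iff l A i j).2 ⟨k, hik, hkj⟩⟩
  simpa [or_imp, forall_and, hA] using hl

theorem reachSet_eq_univ_of_succ_eq {n : ℕ} {M : Set (BMat n)} (hprim : IsPrimitive M)
    {i : Fin n} {t : ℕ} (h : reachSet M i (t + 1) = reachSet M i t) :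
    reachSet M i t = Set.univ := by
  obtain ⟨l, -, hl, hprod⟩ := hprim
  refine Set.eq_univ_of_forall fun j => ?_
  exact mem_of_listProd_apply (fun A hA k hk j hkj => h ▸ mem_reachSet_succ hA hk hkj) hl
    (mem_reachSet_self M i t) (by simp [hprod, bOnes])

theorem IsPrimitive.succ_le_ncard_reachSet {n : ℕ} {M : Set (BMat n)} (hprim : IsPrimitive M)
    (i : Fin n) (t : ℕ) : t + 1 ≤ (reachSet M i t).ncard ∨ reachSet M i t = Set.univ := by
  induction t with
  | zero => exact .inl ((Set.ncard_pos (Set.toFinite _)).2 ⟨i, mem_reachSet_self M i 0⟩)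
  | succ t ih =>
    have hsub := reachSet_subset_succ M i t
    rcases ih with ih | ih
    · by_cases h : reachSet M i (t + 1) = reachSet M i t
      · exact .inr (h.trans (reachSet_eq_univ_of_succ_eq hprim h))
      · have := Set.ncard_lt_ncard (hsub.ssubset_of_ne (Ne.symm h)) (Set.toFinite _)
        exact .inl (by omega)
    · exact .inr (Set.univ_subset_iff.1 (ih ▸ hsub))

theorem IsPrimitive.reachSet_eq_univ {n : ℕ} {M : Set (BMat n)} (hprim : IsPrimitive M)
    (i : Fin n) : reachSet M i (n - 1) = Set.univ := by
  rcases hprim.succ_le_ncard_reachSet i (n - 1) with h | h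
  · have hcard : (Set.univ : Set (Fin n)).ncard = n := by simp [Set.ncard_univ]
    exact Set.eq_of_subset_of_ncard_le (Set.subset_univ _) (by omega) (Set.toFinite _)
  · exact h

theorem rCount_le_rowMaxN {n : ℕ} {M : Set (BMat n)} {t : ℕ} {A : BMat n}
    (hA : A ∈ prodsLe M t) (i : Fin n) : rCount A i ≤ rowMaxN M t i := by
  refine le_csSup ⟨n, ?_⟩ ⟨A, hA, rfl⟩
  rintro _ ⟨B, -, rfl⟩
  exact (Finset.card_le_univ _).trans_eq (Fintype.card_fin n)

theorem IsPrimitive.two_le_rowMaxN {n : ℕ} (hn : 2 ≤ n) {M : Set (BMat n)}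
    (hprim : IsPrimitive M) (i : Fin n) : 2 ≤ rowMaxN M n i := by
  obtain ⟨A, hA, k, j, j', hj, hj', hne⟩ := hprim.exists_branching_row hn
  obtain ⟨_, ⟨l, hlen, hl, rfl⟩, hik⟩ : k ∈ reachSet M i (n - 1) :=
    hprim.reachSet_eq_univ i ▸ Set.mem_univ k
  have hmem : listProd (l ++ [A]) ∈ prodsLe M n := by
    refine ⟨_, ?_, ?_, rfl⟩
    · simp only [List.length_append, List.length_singleton]
      omega
    · simpa [or_imp, forall_and, hA] using hl
  refine le_trans ?_ (rCount_le_rowMaxN hmem i)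
  refine Finset.one_lt_card.2 ⟨j, ?_, j', ?_, hne⟩
  · simpa [listProd_append_singleton_apply_iff] using ⟨k, hik, hj⟩
  · simpa [listProd_append_singleton_apply_iff] using ⟨k, hik, hj'⟩

theorem rowMaxN_zero {n : ℕ} (M : Set (BMat n)) (i : Fin n) : rowMaxN M 0 i = 1 := by
  have hcount : rCount (bId n) i = 1 := by
    simp [rCount, bId_apply_iff, Finset.filter_eq]
  have hset : {r | ∃ A ∈ prodsLe M 0, r = rCount A i} = {1} := by
    ext r
    constructor
    · rintro ⟨_, ⟨l, hlen, -, rfl⟩, rfl⟩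
      obtain rfl := List.length_eq_zero_iff.1 (Nat.le_zero.1 hlen)
      exact hcount
    · rintro rfl
      exact ⟨bId n, ⟨[], by simp, by simp, rfl⟩, hcount.symm⟩
  rw [rowMaxN, hset, csSup_singleton]

theorem exists_KbarN_eq {n : ℕ} [NeZero n] (M : Set (BMat n)) (t : ℕ) :
    ∃ i, KbarN M t = rowMaxN M t i :=
  Nat.sInf_mem (s := {r | ∃ i, r = rowMaxN M t i}) ⟨_, 0, rfl⟩

/-- for `n ≥ 2` and `𝓜` a primitive finite set of `n×n` binary
NZ matrices, `K̄_𝓜(n) > K̄_𝓜(0) = 1/n`. -/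
theorem stmt_15 {n : ℕ} (hn : 2 ≤ n) (M : Set (BMat n)) (hfin : M.Finite)
    (hNZ : ∀ A ∈ M, IsNZ A) (hprim : IsPrimitive M) :
    Kbar M n > Kbar M 0 ∧ Kbar M 0 = 1 / n := by
  have : NeZero n := ⟨by omega⟩
  obtain ⟨i, hi⟩ := exists_KbarN_eq M 0
  obtain ⟨i', hi'⟩ := exists_KbarN_eq M n
  rw [rowMaxN_zero] at hi
  have hlt : KbarN M 0 < KbarN M n := by
    have := hprim.two_le_rowMaxN hn i'
    omega
  refine ⟨?_, by simp [Kbar, hi]⟩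
  exact div_lt_div_of_pos_right (by exact_mod_cast hlt) (by exact_mod_cast NeZero.pos n)
end
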